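/- Let k ≥ 3 be an integer, r := (3^k + 1)/2, and set B := B_{3^k}(r+1) ∖ {(r, r−1), (r, 1^{r−1})}° ⊆ P(3^k). Then B_{2·3^k}(2r+2) ⋆ B = B_{3^{k+1}}(3r+3). -/

import Mathlib

open scoped Classical

namespace SylowBranching

/-- The cells of the Young diagram of `f` (rows indexed by the first coordinate,
starting from `0`; `f i` is the length of row `i`). -/
def cellsOf (f : ℕ → ℕ) : Set (ℕ × ℕ) := {p | p.2 < f p.1}

/-- `f : ℕ → ℕ` is a partition if it is weakly decreasing with finitely many
nonzero parts.  Its parts are `f 0 ≥ f 1 ≥ ⋯`, and its largest part is `f 0`. -/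
def IsPartition (f : ℕ → ℕ) : Prop :=
  Antitone f ∧ ∃ N, ∀ i, N ≤ i → f i = 0

/-- The size `|f|` of a partition: the number of cells of its Young diagram. -/
noncomputable def psize (f : ℕ → ℕ) : ℕ := (cellsOf f).ncard

/-- `P(n)`: the set of partitions of `n`. -/
def Pset (n : ℕ) : Set (ℕ → ℕ) := {f | IsPartition f ∧ psize f = n}

/-- The conjugate (transpose) partition `f'`. -/
noncomputable def conj (f : ℕ → ℕ) : ℕ → ℕ := fun j => Set.ncard {i | j < f i}

/-- `A° = A ∪ A'`: the closure of a set of partitions under conjugation. -/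
noncomputable def conjClosure (A : Set (ℕ → ℕ)) : Set (ℕ → ℕ) := A ∪ conj '' A

/-- `B_n(t)`: partitions of `n` with largest part at most `t` and at most `t` parts. -/
noncomputable def Bset (n t : ℕ) : Set (ℕ → ℕ) :=
  {f ∈ Pset n | f 0 ≤ t ∧ conj f 0 ≤ t}

/-- The cells of the skew shape `l / m`. -/
def skewCells (l m : ℕ → ℕ) : Set (ℕ × ℕ) :=
  {p | m p.1 ≤ p.2 ∧ p.2 < l p.1}

/-- `d` is read before (or at the same time as) `c` in the reading order of a
filling: right-to-left along rows, rows from top to bottom. -/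
def readBefore (d c : ℕ × ℕ) : Prop :=
  d.1 < c.1 ∨ (d.1 = c.1 ∧ c.2 ≤ d.2)

/-- A Littlewood–Richardson filling of the cell set `γ` of weight `ν`:
all entries are positive; for every `j ≥ 1` there are exactly `ν (j-1)` entries
equal to `j` (i.e. the number of `j`s is the `j`-th part of `ν`); entries weakly
increase along rows and strictly increase down columns; and every initial
segment of the reading word (right-to-left along rows, top to bottom) contains
at least as many entries equal to `j` as entries equal to `j+1`, for all `j ≥ 1`. -/
structure IsLRFilling (γ : Set (ℕ × ℕ)) (ν : ℕ → ℕ) (T : ℕ × ℕ → ℕ) : Prop where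
  pos : ∀ c ∈ γ, 1 ≤ T c
  weight : ∀ j : ℕ, 1 ≤ j → Set.ncard {c ∈ γ | T c = j} = ν (j - 1)
  row_weak : ∀ i j j', (i, j) ∈ γ → (i, j') ∈ γ → j ≤ j' → T (i, j) ≤ T (i, j')
  col_strict : ∀ i i' j, (i, j) ∈ γ → (i', j) ∈ γ → i < i' → T (i, j) < T (i', j)
  lattice : ∀ c ∈ γ, ∀ j : ℕ, 1 ≤ j →
    Set.ncard {d ∈ γ | T d = j + 1 ∧ readBefore d c} ≤
      Set.ncard {d ∈ γ | T d = j ∧ readBefore d c}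

/-- `LR(γ)`: the set of all weights of LR fillings of `γ`. -/
def LRset (γ : Set (ℕ × ℕ)) : Set (ℕ → ℕ) := {ν | ∃ T, IsLRFilling γ ν T}

/-- The Littlewood–Richardson coefficient `c^l_{m ν}`: the number of LR fillings
of the skew shape `l / m` of weight `ν` (zero unless `m ⊆ l`); fillings are
normalised to vanish off the skew shape so that they can be counted. -/
noncomputable def LRcoeff (l m ν : ℕ → ℕ) : ℕ :=
  Set.ncard {T : ℕ × ℕ → ℕ |
    (∀ i, m i ≤ l i) ∧ (∀ c, c ∉ skewCells l m → T c = 0) ∧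
      IsLRFilling (skewCells l m) ν T}

/-- The `⋆` operation on sets of partitions:
`A ⋆ B = {λ : c^λ_{μν} > 0 for some μ ∈ A, ν ∈ B}`. -/
def starOp (A B : Set (ℕ → ℕ)) : Set (ℕ → ℕ) :=
  {l | IsPartition l ∧ ∃ μ ∈ A, ∃ ν ∈ B, 0 < LRcoeff l μ ν}

/-- The partition with the given (weakly decreasing) list of parts. -/
def ofList (L : List ℕ) : ℕ → ℕ := fun i => L.getD i 0

/-- The hook partition `(a, 1^b)`. -/
def hookP (a b : ℕ) : ℕ → ℕ := ofList (a :: List.replicate b 1)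

/-- The partition `(a, μ)` obtained by prepending a first part `a` to `μ`. -/
def consPart (a : ℕ) (μ : ℕ → ℕ) : ℕ → ℕ := fun i => if i = 0 then a else μ (i - 1)

/-- `γ` coincides, up to planar translation, with the Young diagram of `ν`. -/
def TranslateOf (γ : Set (ℕ × ℕ)) (ν : ℕ → ℕ) : Prop :=
  ∃ a b : ℕ, γ = (fun p : ℕ × ℕ => (p.1 + a, p.2 + b)) '' cellsOf ν

/-- `γ` coincides, up to planar translation, with the 180°-rotation of the
Young diagram of `ν`. -/
def RotationOf (γ : Set (ℕ × ℕ)) (ν : ℕ → ℕ) : Prop :=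
  ∃ a b : ℕ, (∀ p ∈ cellsOf ν, p.1 ≤ a ∧ p.2 ≤ b) ∧
    γ = (fun p : ℕ × ℕ => (a - p.1, b - p.2)) '' cellsOf ν

/-- Iterated Littlewood–Richardson coefficients `c^l_{μ^1, …, μ^r}`:
`c^l_{μ} = δ_{l μ}`, and the coefficient for a longer list is obtained by
summing, over partitions `g` of the total size of the remaining factors, the
product of the iterated coefficient of `g` with `c^l_{g μ}`. -/
noncomputable def iterLR : List (ℕ → ℕ) → (ℕ → ℕ) → ℕ
  | [], l => if l = (fun _ => 0 : ℕ → ℕ) then 1 else 0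
  | [μ], l => if l = μ then 1 else 0
  | μ :: μs, l =>
      ∑' g : {g : ℕ → ℕ // IsPartition g ∧ psize g = (μs.map psize).sum},
        iterLR μs g.1 * LRcoeff l g.1 μ

/-- `D(q, m, B)`: partitions `λ` of `qm` with `c^λ_{μ_1, …, μ_q} > 0` for some
`μ_1, …, μ_q ∈ B` that are not all equal. -/
noncomputable def Dset (q m : ℕ) (B : Set (ℕ → ℕ)) : Set (ℕ → ℕ) :=
  {l ∈ Pset (q * m) | ∃ μ : Fin q → (ℕ → ℕ),
    (∀ i, μ i ∈ B) ∧ (∃ i j, μ i ≠ μ j) ∧ 0 < iterLR (List.ofFn μ) l}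

/-- Iterated `⋆` of a list of sets of partitions. -/
def starAll : List (Set (ℕ → ℕ)) → Set (ℕ → ℕ)
  | [] => Pset 0
  | [A] => A
  | A :: B :: rest => starOp A (starAll (B :: rest))

/-- `Ω(φ(1,0,…,0))` for the Sylow 3-subgroup of `S_{3^k}` (`k ≥ 4`):
`B_{3^k}(2a) ∖ {(2a, a−1, 1), (2a, 2, 1^{a−2}), (2a−1, a+1), (2a−1, 1^{a+1})}°`
where `a = 3^{k−1}`. -/
noncomputable def Cset (k : ℕ) : Set (ℕ → ℕ) :=
  Bset (3 ^ k) (2 * 3 ^ (k - 1)) \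
    conjClosure
      {ofList [2 * 3 ^ (k - 1), 3 ^ (k - 1) - 1, 1],
       ofList (2 * 3 ^ (k - 1) :: 2 :: List.replicate (3 ^ (k - 1) - 2) 1),
       ofList [2 * 3 ^ (k - 1) - 1, 3 ^ (k - 1) + 1],
       hookP (2 * 3 ^ (k - 1) - 1) (3 ^ (k - 1) + 1)}

open Finset in
theorem psize_eq_sum {f : ℕ → ℕ} {N : ℕ} (h : ∀ i, N ≤ i → f i = 0) :
    psize f = ∑ i ∈ range N, f i := by
  have hcells : cellsOf f =
      (((range N).sigma fun i => range (f i)).image fun x => (x.1, x.2) : Finset (ℕ × ℕ)) := by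
    ext ⟨i, c⟩
    simp only [cellsOf, Set.mem_ofPred_eq, coe_image, Set.mem_image, mem_coe, mem_sigma, mem_range]
    constructor
    · intro hc
      refine ⟨⟨i, c⟩, ⟨?_, hc⟩, rfl⟩
      by_contra hi
      have := h i (not_lt.mp hi)
      omega
    · rintro ⟨⟨i', c'⟩, ⟨-, hc⟩, heq⟩
      simp only [Prod.mk.injEq] at heq
      obtain ⟨rfl, rfl⟩ := heq
      exact hc
  rw [psize, hcells, Set.ncard_coe_finset, card_image_of_injective, card_sigma]
  · simp
  · rintro ⟨i, c⟩ ⟨i', c'⟩ heq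
    simpa using heq

theorem finite_rows {f : ℕ → ℕ} {N : ℕ} (h : ∀ i, N ≤ i → f i = 0) (j : ℕ) :
    {i | j < f i}.Finite := by
  refine (Set.finite_Iio N).subset fun i hi => ?_
  by_contra hN
  have := h i (not_lt.mp hN)
  simp only [Set.mem_ofPred_eq] at hi
  omega

theorem finite_cellsOf {f : ℕ → ℕ} (hf : IsPartition f) : (cellsOf f).Finite := by
  obtain ⟨hanti, N, hN⟩ := hf
  refine ((Set.finite_Iio N).prod (Set.finite_Iio (f 0))).subset ?_
  rintro ⟨i, c⟩ hc
  simp only [cellsOf, Set.mem_ofPred_eq] at hc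
  refine ⟨?_, lt_of_lt_of_le hc (hanti (Nat.zero_le i))⟩
  by_contra hi
  have := hN i (not_lt.mp hi)
  omega

theorem finite_skewCells {l m : ℕ → ℕ} (hl : IsPartition l) : (skewCells l m).Finite :=
  (finite_cellsOf hl).subset fun _ hp => hp.2

theorem lt_conj_iff {f : ℕ → ℕ} (hf : IsPartition f) (i j : ℕ) : i < conj f j ↔ j < f i := by
  obtain ⟨hanti, N, hN⟩ := hf
  have hex : ∃ i, f i ≤ j := ⟨N, by simp [hN N le_rfl]⟩
  have hset : {i | j < f i} = Set.Iio (Nat.find hex) := by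
    ext i
    simp only [Set.mem_ofPred_eq, Set.mem_Iio, Nat.lt_find_iff, not_le]
    exact ⟨fun h m hm => lt_of_lt_of_le h (hanti hm), fun h => h i le_rfl⟩
  have hcard : conj f j = Nat.find hex := by
    rw [conj, hset, Set.ncard_eq_toFinset_card']
    simp
  rw [hcard, ← Set.mem_Iio, ← hset, Set.mem_ofPred_eq]

theorem isPartition_conj {f : ℕ → ℕ} {N : ℕ} (h : ∀ i, N ≤ i → f i = 0) :
    IsPartition (conj f) := by
  refine ⟨fun a b hab => ?_, ∑ i ∈ Finset.range N, f i, fun j hj => ?_⟩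
  · exact Set.ncard_le_ncard (fun i hi => lt_of_le_of_lt hab hi) (finite_rows h a)
  · have hempty : {i | j < f i} = ∅ := by
      ext i
      simp only [Set.mem_ofPred_eq, Set.mem_empty_iff_false, iff_false, not_lt]
      rcases lt_or_ge i N with hi | hi
      · exact (Finset.single_le_sum (fun _ _ => Nat.zero_le _) (Finset.mem_range.mpr hi)).trans hj
      · simp [h i hi]
    simp [conj, hempty]

theorem conj_eq_card {f : ℕ → ℕ} {N : ℕ} (h : ∀ i, N ≤ i → f i = 0) (j : ℕ) :
    conj f j = ((Finset.range N).filter fun i => j < f i).card := by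
  rw [conj, ← Set.ncard_coe_finset]
  congr 1
  ext i
  simp only [Set.mem_ofPred_eq, Finset.coe_filter, Finset.mem_range]
  refine ⟨fun hi => ⟨?_, hi⟩, fun hi => hi.2⟩
  by_contra hN
  have := h i (not_lt.mp hN)
  omega

theorem psize_conj {f : ℕ → ℕ} {N : ℕ} (h : ∀ i, N ≤ i → f i = 0) :
    psize (conj f) = ∑ i ∈ Finset.range N, f i := by
  obtain ⟨-, M, hM⟩ := isPartition_conj h
  have hle : ∀ i ∈ Finset.range N, f i ≤ M := by
    intro i hi
    by_contra hlt
    have h0 := hM M le_rfl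
    rw [conj_eq_card h, Finset.card_eq_zero, Finset.filter_eq_empty_iff] at h0
    exact h0 hi (not_le.mp hlt)
  rw [psize_eq_sum hM]
  simp only [conj_eq_card h, Finset.card_filter]
  rw [Finset.sum_comm]
  refine Finset.sum_congr rfl fun i hi => ?_
  rw [← Finset.card_filter]
  have : (Finset.range M).filter (fun j => j < f i) = Finset.range (f i) := by
    ext j
    have := hle i hi
    simp only [Finset.mem_filter, Finset.mem_range]
    omega
  rw [this, Finset.card_range]

theorem conj_conj {f : ℕ → ℕ} (hf : IsPartition f) : conj (conj f) = f := by
  funext i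
  have : {j | i < conj f j} = Set.Iio (f i) := by
    ext j
    exact lt_conj_iff hf i j
  rw [conj, this, Set.ncard_eq_toFinset_card']
  simp

theorem IsPartition.conj {f : ℕ → ℕ} (hf : IsPartition f) : IsPartition (conj f) :=
  isPartition_conj hf.2.choose_spec

theorem IsPartition.psize_conj {f : ℕ → ℕ} (hf : IsPartition f) :
    psize (SylowBranching.conj f) = psize f := by
  obtain ⟨-, N, hN⟩ := hf
  rw [SylowBranching.psize_conj hN, psize_eq_sum hN]

/-- Bounding every value of `f` by `t` bounds the number of columns of its row diagram. -/
theorem conj_conj_zero_le {f : ℕ → ℕ} {t : ℕ} (h : ∀ i, f i ≤ t) : conj (conj f) 0 ≤ t := by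
  have hsub : {k | 0 < conj f k} ⊆ Set.Iio t := by
    intro k hk
    by_contra hlt
    have hempty : {i | k < f i} = ∅ := by
      ext i
      have := h i
      simp only [Set.mem_Iio, not_lt] at hlt
      simp only [Set.mem_ofPred_eq, Set.mem_empty_iff_false, iff_false]
      omega
    simp [conj, hempty] at hk
  calc conj (conj f) 0 ≤ (Set.Iio t).ncard := Set.ncard_le_ncard hsub (Set.finite_Iio t)
    _ = t := by rw [Set.ncard_eq_toFinset_card']; simp

/-- Some cell of `γ` in row `i` has key `k`. -/
def HasKey (γ : Set (ℕ × ℕ)) (κ : ℕ × ℕ → ℕ) (k i : ℕ) : Prop :=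
  ∃ c, (i, c) ∈ γ ∧ κ (i, c) = k

/-- The rank of a cell among the cells with the same key, ordered by rows. -/
noncomputable def keyRank (γ : Set (ℕ × ℕ)) (κ : ℕ × ℕ → ℕ) (c : ℕ × ℕ) : ℕ :=
  Nat.count (HasKey γ κ (κ c)) c.1 + 1

/-- If keys are distinct within each row, then ranking the cells by rows within each key class
is an LR filling, provided that it is semistandard. -/
theorem isLRFilling_keyRank {γ : Set (ℕ × ℕ)} (hγ : γ.Finite) (κ : ℕ × ℕ → ℕ)
    (hκ : ∀ i j j', (i, j) ∈ γ → (i, j') ∈ γ → κ (i, j) = κ (i, j') → j = j')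
    (hrow : ∀ i j j', (i, j) ∈ γ → (i, j') ∈ γ → j ≤ j' → keyRank γ κ (i, j) ≤ keyRank γ κ (i, j'))
    (hcol : ∀ i i' j, (i, j) ∈ γ → (i', j) ∈ γ → i < i' →
      keyRank γ κ (i, j) < keyRank γ κ (i', j)) :
    IsLRFilling γ (conj fun k => Set.ncard {i | HasKey γ κ k i}) (keyRank γ κ) := by
  have hself : ∀ c ∈ γ, HasKey γ κ (κ c) c.1 := fun c hc => ⟨c.2, hc, rfl⟩
  have hfin : ∀ k, (Set.ofPred (HasKey γ κ k)).Finite := fun k => by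
    refine (hγ.image Prod.fst).subset ?_
    rintro i ⟨c, hc, -⟩
    exact ⟨(i, c), hc, rfl⟩
  have hinj : ∀ c ∈ γ, ∀ d ∈ γ, κ c = κ d → keyRank γ κ c = keyRank γ κ d → c = d := by
    rintro ⟨i, c⟩ hc ⟨i', c'⟩ hd hk hrank
    have hi := hself _ hc
    have hi' := hself _ hd
    simp only [keyRank, hk, add_left_inj] at hrank hi hi'
    obtain rfl := Nat.count_injective hi hi' hrank
    rw [hκ _ _ _ hc hd hk]
  refine ⟨fun c _ => Nat.succ_le_succ (Nat.zero_le _), fun j hj => ?_, hrow, hcol,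
    fun c _ j hj => ?_⟩
  · refine Set.ncard_congr (fun c _ => κ c) ?_ ?_ ?_
    · rintro c ⟨hc, hrank⟩
      have := Nat.count_lt_card (hfin (κ c)) (hself c hc)
      rw [← Set.ncard_eq_toFinset_card _ (hfin (κ c))] at this
      simp only [Set.mem_ofPred_eq]
      simp only [keyRank] at hrank
      exact lt_of_le_of_lt (by omega) this
    · rintro c d ⟨hc, hcr⟩ ⟨hd, hdr⟩ hk
      exact hinj c hc d hd hk (hcr.trans hdr.symm)
    · intro k hk
      have hlt : ∀ hf : (Set.ofPred (HasKey γ κ k)).Finite, j - 1 < hf.toFinset.card := by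
        intro hf
        rw [← Set.ncard_eq_toFinset_card _ hf]
        exact hk
      obtain ⟨c, hc, hck⟩ := Nat.nth_mem _ hlt
      refine ⟨(_, c), ⟨hc, ?_⟩, hck⟩
      simp only [keyRank, hck, Nat.count_nth hlt]
      omega
  · have hex : ∀ d : ℕ × ℕ, ∃ d' : ℕ × ℕ, d ∈ γ → keyRank γ κ d = j + 1 →
        d' ∈ γ ∧ keyRank γ κ d' = j ∧ κ d' = κ d ∧ d'.1 < d.1 := by
      intro d
      by_cases hd : d ∈ γ ∧ keyRank γ κ d = j + 1
      · have hlt : j - 1 < Nat.count (HasKey γ κ (κ d)) d.1 := by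
          have := hd.2
          simp only [keyRank] at this
          omega
        have hcard : ∀ hf : (Set.ofPred (HasKey γ κ (κ d))).Finite, j - 1 < hf.toFinset.card :=
          fun hf => hlt.trans_le (Nat.count_le_card hf _)
        obtain ⟨c', hc', hk'⟩ := Nat.nth_mem _ hcard
        refine ⟨(_, c'), fun _ _ => ⟨hc', ?_, hk', Nat.nth_lt_of_lt_count hlt⟩⟩
        simp only [keyRank, hk', Nat.count_nth hcard]
        omega
      · exact ⟨d, fun h₁ h₂ => absurd ⟨h₁, h₂⟩ hd⟩
    choose up hup using hex
    refine Set.ncard_le_ncard_of_injOn up ?_ ?_ (hγ.subset fun d hd => hd.1)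
    · rintro d ⟨hd, hrank, hread⟩
      obtain ⟨h₁, h₂, -, h₄⟩ := hup d hd hrank
      refine ⟨h₁, h₂, Or.inl ?_⟩
      rcases hread with h | h <;> omega
    · rintro d ⟨hd, hrank, -⟩ d' ⟨hd', hrank', -⟩ heq
      have h₁ := (hup d hd hrank).2.2.1
      have h₂ := (hup d' hd' hrank').2.2.1
      exact hinj d hd d' hd' (by rw [← h₁, ← h₂, heq]) (hrank.trans hrank'.symm)

theorem IsLRFilling.congr {γ : Set (ℕ × ℕ)} {ν : ℕ → ℕ} {T T' : ℕ × ℕ → ℕ}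
    (h : IsLRFilling γ ν T) (heq : ∀ c ∈ γ, T' c = T c) : IsLRFilling γ ν T' := by
  have hset : ∀ (P : ℕ → ℕ × ℕ → Prop),
      {d ∈ γ | P (T' d) d} = {d ∈ γ | P (T d) d} := by
    intro P
    ext d
    refine and_congr_right fun hd => ?_
    rw [heq d hd]
  refine ⟨fun c hc => heq c hc ▸ h.pos c hc, fun j hj => ?_, fun i j j' hj hj' hle => ?_,
    fun i i' j hi hi' hlt => ?_, fun c hc j hj => ?_⟩
  · rw [hset fun x _ => x = j]
    exact h.weight j hj
  · rw [heq _ hj, heq _ hj']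
    exact h.row_weak i j j' hj hj' hle
  · rw [heq _ hi, heq _ hi']
    exact h.col_strict i i' j hi hi' hlt
  · rw [hset fun x d => x = j + 1 ∧ readBefore d c, hset fun x d => x = j ∧ readBefore d c]
    exact h.lattice c hc j hj

theorem IsLRFilling.weight_pos {γ : Set (ℕ × ℕ)} {ν : ℕ → ℕ} {T : ℕ × ℕ → ℕ} (hγ : γ.Finite)
    (h : IsLRFilling γ ν T) {c : ℕ × ℕ} (hc : c ∈ γ) : 0 < ν (T c - 1) := by
  rw [← h.weight (T c) (h.pos c hc), Set.ncard_pos (hγ.subset fun d hd => hd.1)]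
  exact ⟨c, hc, rfl⟩

theorem LRcoeff_pos {l m ν : ℕ → ℕ} {T : ℕ × ℕ → ℕ} (hl : IsPartition l) (hν : IsPartition ν)
    (hml : ∀ i, m i ≤ l i) (hT : IsLRFilling (skewCells l m) ν T) : 0 < LRcoeff l m ν := by
  obtain ⟨-, N, hN⟩ := hν
  have hγ := finite_skewCells (m := m) hl
  refine (Set.ncard_pos ?_).mpr ?_
  rotate_left
  · refine ⟨fun c => if c ∈ skewCells l m then T c else 0, hml, fun c hc => if_neg hc,
      hT.congr fun c hc => if_pos hc⟩
  · have : Finite (skewCells l m) := hγ.to_subtype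
    have hpi := Set.Finite.pi' (ι := skewCells l m) (κ := fun _ => ℕ)
      (t := fun _ => Set.Iic N) (fun _ => Set.finite_Iic N)
    refine Set.Finite.of_finite_image (f := fun T (c : skewCells l m) => T c.1)
      (hpi.subset ?_) ?_
    · rintro _ ⟨T', ⟨-, -, hT'⟩, rfl⟩ c
      have hpos := hT'.weight_pos hγ c.2
      simp only [Set.mem_Iic]
      by_contra hlt
      rw [hN _ (by omega)] at hpos
      exact lt_irrefl 0 hpos
    · rintro T₁ ⟨-, hz₁, -⟩ T₂ ⟨-, hz₂, -⟩ heq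
      funext c
      by_cases hc : c ∈ skewCells l m
      · exact congrFun heq ⟨c, hc⟩
      · rw [hz₁ c hc, hz₂ c hc]

theorem exists_isLRFilling_of_LRcoeff_pos {l m ν : ℕ → ℕ} (h : 0 < LRcoeff l m ν) :
    (∀ i, m i ≤ l i) ∧ ∃ T, IsLRFilling (skewCells l m) ν T := by
  obtain ⟨T, hml, -, hT⟩ := Set.nonempty_of_ncard_ne_zero h.ne'
  exact ⟨hml, T, hT⟩

/-- The weight whose parts are the sorted row lengths of `l / m` occurs. -/
theorem LRcoeff_row_lengths_pos {l m : ℕ → ℕ} (hl : IsPartition l)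
    (hml : ∀ i, m i ≤ l i) : 0 < LRcoeff l m (conj (conj fun i => l i - m i)) := by
  obtain ⟨hanti, N, hN⟩ := id hl
  have hρ : ∀ i, N ≤ i → l i - m i = 0 := fun i hi => by simp [hN i hi]
  have hkey : ∀ k i, HasKey (skewCells l m) (fun c => l c.1 - c.2 - 1) k i ↔ k < l i - m i := by
    intro k i
    constructor
    · rintro ⟨c, ⟨h₁, h₂⟩, rfl⟩
      simp only at h₁ h₂ ⊢
      omega
    · intro hk
      refine ⟨l i - k - 1, ⟨?_, ?_⟩, ?_⟩ <;> simp only <;> omega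
  have hfill := isLRFilling_keyRank (finite_skewCells (m := m) hl) (fun c => l c.1 - c.2 - 1)
    (by
      rintro i j j' ⟨-, h₁⟩ ⟨-, h₂⟩ heq
      simp only at h₁ h₂ heq
      omega)
    (by
      rintro i j j' ⟨-, h₁⟩ ⟨-, h₂⟩ hle
      refine Nat.succ_le_succ (Nat.count_mono_left fun i' _ => ?_)
      simp only [hkey]
      omega)
    (by
      rintro i i' j ⟨h₀, h₁⟩ ⟨h₂, h₃⟩ hlt
      refine Nat.succ_lt_succ (lt_of_lt_of_le ?_ (Nat.count_monotone _ hlt))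
      simp only at h₀ h₁ h₂ h₃
      have := hanti hlt.le
      rw [Nat.count_succ_eq_succ_count ((hkey _ _).mpr ?_)]
      · refine Nat.lt_succ_of_le (Nat.count_mono_left fun i'' _ => ?_)
        simp only [hkey]
        omega
      · simp only
        omega)
  have hν : (fun k => Set.ncard {i | HasKey (skewCells l m) (fun c => l c.1 - c.2 - 1) k i}) =
      conj fun i => l i - m i := by
    funext k
    simp only [hkey]
    rfl
  rw [hν] at hfill
  exact LRcoeff_pos hl (isPartition_conj hρ).conj hml hfill

/-- The weight conjugate to the sorted column lengths of `l / m` occurs. -/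
theorem LRcoeff_col_lengths_pos {l m : ℕ → ℕ} (hl : IsPartition l) (hm : IsPartition m)
    (hml : ∀ i, m i ≤ l i) : 0 < LRcoeff l m (conj fun j => conj l j - conj m j) := by
  have hkey : ∀ k i, HasKey (skewCells l m) Prod.snd k i ↔ m i ≤ k ∧ k < l i := by
    intro k i
    exact ⟨fun ⟨c, h, hk⟩ => by subst hk; exact h, fun h => ⟨k, h, rfl⟩⟩
  have hfill := isLRFilling_keyRank (finite_skewCells (m := m) hl) Prod.snd
    (fun _ _ _ _ _ heq => heq)
    (by
      rintro i j j' ⟨h₀, h₁⟩ ⟨h₂, h₃⟩ hle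
      refine Nat.succ_le_succ (Nat.count_mono_left fun i' hi' => ?_)
      simp only [hkey] at h₀ h₁ h₂ h₃ ⊢
      have : l i ≤ l i' := hl.1 hi'.le
      omega)
    (by
      rintro i i' j hi - hlt
      refine Nat.succ_lt_succ (lt_of_lt_of_le ?_ (Nat.count_monotone _ hlt))
      rw [Nat.count_succ_eq_succ_count ((hkey _ _).mpr hi)]
      exact Nat.lt_succ_self _)
  have hν : (fun k => Set.ncard {i | HasKey (skewCells l m) Prod.snd k i}) =
      fun j => conj l j - conj m j := by
    funext k
    have hset : {i | HasKey (skewCells l m) Prod.snd k i} =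
        (Finset.Ico (conj m k) (conj l k) : Finset ℕ) := by
      ext i
      simp only [Set.mem_ofPred_eq, hkey, Finset.coe_Ico, Set.mem_Ico, lt_conj_iff hl, ← not_lt,
        lt_conj_iff hm]
    rw [hset, Set.ncard_coe_finset, Nat.card_Ico]
  rw [hν] at hfill
  obtain ⟨-, N, hN⟩ := hl.conj
  exact LRcoeff_pos hl (isPartition_conj (N := N) fun j hj => by simp [hN j hj]) hml hfill

theorem psize_eq_add_ncard_skewCells {l m : ℕ → ℕ} (hl : IsPartition l) (hml : ∀ i, m i ≤ l i) :
    psize l = psize m + (skewCells l m).ncard := by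
  have hsub : cellsOf m ⊆ cellsOf l := fun p hp => lt_of_lt_of_le hp (hml p.1)
  rw [psize, psize, ← Set.ncard_union_eq _ ((finite_cellsOf hl).subset hsub) (finite_skewCells hl)]
  · congr 1
    ext p
    have := hml p.1
    simp only [cellsOf, skewCells, Set.mem_union, Set.mem_ofPred_eq]
    omega
  · rw [Set.disjoint_left]
    intro p hp hp'
    simp only [cellsOf, skewCells, Set.mem_ofPred_eq] at hp hp'
    omega

theorem IsLRFilling.ncard_eq_psize {γ : Set (ℕ × ℕ)} {ν : ℕ → ℕ} {T : ℕ × ℕ → ℕ} (hγ : γ.Finite)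
    (hν : IsPartition ν) (h : IsLRFilling γ ν T) : γ.ncard = psize ν := by
  obtain ⟨-, N, hN⟩ := hν
  rw [psize_eq_sum hN, Set.ncard_eq_toFinset_card _ hγ,
    Finset.card_eq_sum_card_fiberwise (f := fun c => T c - 1) (t := Finset.range N)]
  · refine Finset.sum_congr rfl fun j _ => ?_
    rw [show ν j = ν (j + 1 - 1) from rfl, ← h.weight (j + 1) (by omega), ← Set.ncard_coe_finset]
    congr 1
    ext c
    simp only [Finset.coe_filter, Set.Finite.mem_toFinset, Set.mem_ofPred_eq]
    refine and_congr_right fun hc => ?_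
    have := h.pos c hc
    omega
  · intro c hc
    rw [Finset.mem_coe, Set.Finite.mem_toFinset] at hc
    have hpos := h.weight_pos hγ hc
    rw [Finset.mem_coe, Finset.mem_range]
    by_contra hlt
    rw [hN _ (not_lt.mp hlt)] at hpos
    exact lt_irrefl 0 hpos

theorem first_part_le_of_isLRFilling {l m ν : ℕ → ℕ} {T : ℕ × ℕ → ℕ} (hl : IsPartition l)
    (hT : IsLRFilling (skewCells l m) ν T) : l 0 ≤ m 0 + ν 0 := by
  rcases le_or_gt (l 0) (m 0) with h | h
  · omega
  have hγ := finite_skewCells (m := m) hl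
  have hlast : (0, l 0 - 1) ∈ skewCells l m := ⟨by simp only; omega, by simp only; omega⟩
  have hone : T (0, l 0 - 1) = 1 := by
    by_contra hne
    obtain ⟨j, hj⟩ : ∃ j, T (0, l 0 - 1) = j + 1 := ⟨_, (Nat.sub_add_cancel (hT.pos _ hlast)).symm⟩
    have hlat := hT.lattice _ hlast j (by omega)
    have hpos : 0 < Set.ncard {d ∈ skewCells l m | T d = j + 1 ∧ readBefore d (0, l 0 - 1)} :=
      (Set.ncard_pos (hγ.subset fun d hd => hd.1)).mpr ⟨_, hlast, hj, Or.inr ⟨rfl, le_rfl⟩⟩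
    obtain ⟨⟨i, c⟩, ⟨-, hlt⟩, hd, hread⟩ := Set.nonempty_of_ncard_ne_zero (hpos.trans_le hlat).ne'
    rcases hread with hr | ⟨hr, hc⟩
    · exact absurd hr (Nat.not_lt_zero _)
    · simp only at hr hc hlt
      subst hr
      have : c = l 0 - 1 := by omega
      subst this
      omega
  have hsub : (fun c => (0, c)) '' (Finset.Ico (m 0) (l 0) : Set ℕ) ⊆
      {c ∈ skewCells l m | T c = 1} := by
    rintro _ ⟨c, hc, rfl⟩
    rw [Finset.coe_Ico] at hc
    have hmem : (0, c) ∈ skewCells l m := hc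
    have h₁ := hT.row_weak 0 c (l 0 - 1) hmem hlast (by have := hc.2; omega)
    have h₂ := hT.pos _ hmem
    exact ⟨hmem, le_antisymm (h₁.trans hone.le) h₂⟩
  have hcard := Set.ncard_le_ncard hsub (hγ.subset fun d hd => hd.1)
  rw [hT.weight 1 le_rfl, Set.ncard_image_of_injective _ (Prod.mk_right_injective 0),
    Set.ncard_coe_finset, Nat.card_Ico] at hcard
  simp only [Nat.sub_self] at hcard
  omega

theorem length_le_of_isLRFilling {l m ν : ℕ → ℕ} {T : ℕ × ℕ → ℕ} (hl : IsPartition l)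
    (hm : IsPartition m) (hν : IsPartition ν) (hT : IsLRFilling (skewCells l m) ν T) :
    conj l 0 ≤ conj m 0 + conj ν 0 := by
  have hmem : ∀ i, conj m 0 ≤ i → i < conj l 0 → (i, 0) ∈ skewCells l m := by
    intro i h₁ h₂
    rw [← not_lt, lt_conj_iff hm, not_lt] at h₁
    exact ⟨h₁, (lt_conj_iff hl i 0).mp h₂⟩
  have hgrow : ∀ d, conj m 0 + d < conj l 0 → d < T (conj m 0 + d, 0) := by
    intro d
    induction d with
    | zero => exact fun h => hT.pos _ (hmem _ (by omega) h)
    | succ d ih =>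
      intro h
      have h₁ := ih (by omega)
      have h₂ := hT.col_strict (conj m 0 + d) (conj m 0 + (d + 1)) 0 (hmem _ (by omega) (by omega))
        (hmem _ (by omega) h) (by omega)
      omega
  by_contra hlt
  have hlt' : conj m 0 + conj ν 0 < conj l 0 := not_le.mp hlt
  have h₁ := hgrow (conj ν 0) hlt'
  have h₂ := hT.weight_pos (finite_skewCells hl) (hmem _ (by omega) hlt')
  rw [← lt_conj_iff hν] at h₂
  omega

/-- Corners can be removed one at a time from rows in `S` until a prescribed size is reached, as
long as every intermediate shape has a corner in a row from which fewer than `C` cells of `l` are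
missing. -/
theorem exists_partition_of_removable_corner {l : ℕ → ℕ} {S : ℕ → Prop} {C M L : ℕ}
    {m₀ : ℕ → ℕ} (hcorner : ∀ m : ℕ → ℕ, Antitone m → (∀ i, m i ≤ m₀ i) → (∀ i, l i ≤ m i + C) →
      (∀ i, ¬S i → m i = l i) → M < ∑ i ∈ Finset.range L, m i →
      ∃ i, S i ∧ m (i + 1) < m i ∧ l i < m i + C)
    (hanti : Antitone m₀) (hcap : ∀ i, l i ≤ m₀ i + C) (hoff : ∀ i, ¬S i → m₀ i = l i)
    (hL : ∀ i, L ≤ i → m₀ i = 0) (hM : M ≤ ∑ i ∈ Finset.range L, m₀ i) :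
    ∃ m : ℕ → ℕ, Antitone m ∧ (∀ i, m i ≤ m₀ i) ∧ (∀ i, l i ≤ m i + C) ∧
      (∀ i, ¬S i → m i = l i) ∧ ∑ i ∈ Finset.range L, m i = M := by
  suffices h : ∀ d, d + M ≤ ∑ i ∈ Finset.range L, m₀ i →
      ∃ m : ℕ → ℕ, Antitone m ∧ (∀ i, m i ≤ m₀ i) ∧ (∀ i, l i ≤ m i + C) ∧
        (∀ i, ¬S i → m i = l i) ∧ ∑ i ∈ Finset.range L, m i + d = ∑ i ∈ Finset.range L, m₀ i by
    obtain ⟨m, h₁, h₂, h₃, h₄, h₅⟩ := h (∑ i ∈ Finset.range L, m₀ i - M) (by omega)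
    exact ⟨m, h₁, h₂, h₃, h₄, by omega⟩
  intro d
  induction d with
  | zero => exact fun _ => ⟨m₀, hanti, fun _ => le_rfl, hcap, hoff, rfl⟩
  | succ d ih =>
    intro hd
    obtain ⟨m, h₁, h₂, h₃, h₄, h₅⟩ := ih (by omega)
    obtain ⟨i, hS, hi, hC⟩ := hcorner m h₁ h₂ h₃ h₄ (by omega)
    have hiL : i < L := by
      by_contra hlt
      have := h₂ i
      have := hL i (not_lt.mp hlt)
      omega
    refine ⟨fun i' => if i' = i then m i - 1 else m i', ?_, ?_, ?_, ?_, ?_⟩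
    · refine antitone_nat_of_succ_le fun n => ?_
      have hn : m (n + 1) ≤ m n := h₁ (Nat.le_succ n)
      split_ifs with h h' h'
      · omega
      · rw [← h]; omega
      · subst h'; omega
      · exact hn
    · intro i'
      have := h₂ i'
      simp only
      split_ifs with h
      · subst h; omega
      · exact this
    · intro i'
      have := h₃ i'
      simp only
      split_ifs with h
      · subst h; omega
      · exact this
    · intro i' hi'
      have hne : i' ≠ i := fun h => hi' (h ▸ hS)
      simp only [hne, if_false]
      exact h₄ i' hi'
    · have hmem : i ∈ Finset.range L := Finset.mem_range.mpr hiL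
      rw [← Finset.add_sum_erase _ _ hmem] at h₅ ⊢
      have hcongr : ∑ x ∈ (Finset.range L).erase i, (if x = i then m i - 1 else m x) =
          ∑ x ∈ (Finset.range L).erase i, m x :=
        Finset.sum_congr rfl fun x hx => if_neg (Finset.ne_of_mem_erase hx)
      rw [hcongr, if_pos rfl]
      omega

theorem add_sum_Ico_le_sum_range {f : ℕ → ℕ} {i q L : ℕ} (hi : i < q) (hiL : i < L) :
    f i + ∑ x ∈ Finset.Ico q L, f x ≤ ∑ x ∈ Finset.range L, f x := by
  have hnot : i ∉ Finset.Ico q L := by simp only [Finset.mem_Ico]; omega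
  rw [← Finset.sum_insert hnot]
  refine Finset.sum_le_sum_of_subset fun x hx => ?_
  simp only [Finset.mem_insert, Finset.mem_Ico, Finset.mem_range] at hx ⊢
  omega

theorem sum_Ico_le_sum_range {f : ℕ → ℕ} {q L : ℕ} :
    ∑ x ∈ Finset.Ico q L, f x ≤ ∑ x ∈ Finset.range L, f x := by
  refine Finset.sum_le_sum_of_subset fun x hx => ?_
  simp only [Finset.mem_Ico, Finset.mem_range] at hx ⊢
  omega

theorem sum_Ico_eq_of_forall_eq_zero {l m : ℕ → ℕ} {q L R : ℕ} (hR : ∀ i, R ≤ i → m i = 0)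
    (hq : R ≤ q) : ∑ x ∈ Finset.Ico q L, (l x - m x) = ∑ x ∈ Finset.Ico q L, l x :=
  Finset.sum_congr rfl fun x hx => by
    rw [hR x (hq.trans (Finset.mem_Ico.mp hx).1), Nat.sub_zero]

/-- If the last two rows of `m` lie in `S` and every corner of `m` in `S` misses `C` cells of `l`,
then `l / m` has at least `2 * C` cells. -/
theorem two_mul_le_sum_of_last_rows {l m : ℕ → ℕ} {S : ℕ → Prop} {C L R : ℕ} (hl : Antitone l)
    (hfull : ∀ i, S i → m (i + 1) < m i → m i + C ≤ l i) (hm : Antitone m)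
    (hR : ∀ i, 0 < m i ↔ i < R + 2) (hL : R + 1 < L) (h₁ : S (R + 1)) (h₀ : S R) :
    2 * C ≤ ∑ i ∈ Finset.range L, (l i - m i) := by
  have hR₁ := (hR (R + 1)).mpr (by omega)
  have hR₂ : ¬0 < m (R + 1 + 1) := by rw [hR]; omega
  have hlast := hfull (R + 1) h₁ (by omega)
  have hmR : m (R + 1) ≤ m R := hm (Nat.le_succ R)
  have hlR : l (R + 1) ≤ l R := hl (Nat.le_succ R)
  have hprev : m R + C ≤ l R := by
    rcases lt_or_ge (m (R + 1)) (m R) with h | h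
    · exact hfull R h₀ h
    · omega
  have hsum := add_sum_Ico_le_sum_range (f := fun i => l i - m i) (i := R) (q := R + 1) (L := L)
    (by omega) (by omega)
  rw [Finset.sum_eq_sum_Ico_succ_bot hL] at hsum
  simp only at hsum
  omega

theorem sum_range_sub_add_sum_range {l m : ℕ → ℕ} (hml : ∀ i, m i ≤ l i) (L : ℕ) :
    ∑ i ∈ Finset.range L, (l i - m i) + ∑ i ∈ Finset.range L, m i = ∑ i ∈ Finset.range L, l i := by
  rw [← Finset.sum_add_distrib]
  exact Finset.sum_congr rfl fun i _ => Nat.sub_add_cancel (hml i)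

theorem sum_range_le_of_conj_le_one {m : ℕ → ℕ} (hm : IsPartition m) (h : conj m 0 ≤ 1) (L : ℕ) :
    ∑ i ∈ Finset.range L, m i ≤ m 0 := by
  have hz : ∀ i, i ≠ 0 → m i = 0 := fun i hi => by
    have := (lt_conj_iff hm i 0).not
    omega
  calc ∑ i ∈ Finset.range L, m i ≤ ∑ i ∈ Finset.range (L + 1), m i := by
        rw [Finset.sum_range_succ]; omega
    _ = m 0 := Finset.sum_eq_single 0 (fun i _ hi => hz i hi) (by simp)

theorem sub_le_sum_Ico {l : ℕ → ℕ} (hl : IsPartition l) (q : ℕ) :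
    conj l 0 - q ≤ ∑ i ∈ Finset.Ico q (conj l 0), l i := by
  calc conj l 0 - q = ∑ i ∈ Finset.Ico q (conj l 0), 1 := by simp
    _ ≤ _ := Finset.sum_le_sum fun i hi =>
      (lt_conj_iff hl i 0).mp (Finset.mem_Ico.mp hi).2

/-- A corner can be removed from the first row or the bottom `r` rows. -/
theorem exists_corner_first_or_bottom {l m : ℕ → ℕ} {r L : ℕ} (hr : 14 ≤ r)
    (hl : IsPartition l) (hL : conj l 0 = L) (hsum : ∑ i ∈ Finset.range L, l i = 6 * r - 3)
    (hbig : 2 ≤ L - r → 2 * r - 1 ≤ l 0 - l 1 + ∑ i ∈ Finset.Ico (L - r) L, l i)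
    (hm : IsPartition m) (hml : ∀ i, m i ≤ l i) (hm0 : m 0 ≤ 2 * r + 2)
    (hoff : ∀ i, ¬(i = 0 ∨ L - r ≤ i) → m i = l i)
    (hM : 4 * r - 2 < ∑ i ∈ Finset.range L, m i) :
    ∃ i, (i = 0 ∨ L - r ≤ i) ∧ m (i + 1) < m i ∧ l i < m i + (r + 1) := by
  by_contra! hstuck
  have hrest := sum_range_sub_add_sum_range hml L
  have hmR := fun i => lt_conj_iff hm i 0
  have hRL : conj m 0 ≤ L := by
    by_contra hlt
    have h₁ := (hmR L).mp (not_le.mp hlt)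
    have h₂ := (lt_conj_iff hl L 0).not
    have := hml L
    omega
  rcases le_or_gt (conj m 0) 1 with hR | hR
  · have := sum_range_le_of_conj_le_one hm hR L
    omega
  obtain ⟨R, hRe⟩ : ∃ R, conj m 0 = R + 2 := ⟨_, (Nat.sub_add_cancel hR).symm⟩
  rw [hRe] at hmR hRL
  have hzero : ∀ i, R + 2 ≤ i → m i = 0 := fun i hi => by
    have := hmR i
    omega
  have hlastpos := (hmR (R + 1)).mp (by omega)
  have hend : m (R + 1 + 1) = 0 := hzero _ le_rfl
  by_cases h₁ : L - r ≤ R + 1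
  · by_cases h₀ : R = 0 ∨ L - r ≤ R
    · have := two_mul_le_sum_of_last_rows (S := fun i => i = 0 ∨ L - r ≤ i) (R := R) (L := L)
        hl.1 hstuck hm.1 (fun i => (hmR i).symm) (by omega) (Or.inr h₁) h₀
      omega
    · have hfull := hstuck (R + 1) (Or.inr h₁) (by omega)
      have hle := add_sum_Ico_le_sum_range (f := fun i => l i - m i) (i := R + 1) (q := R + 2)
        (L := L) (by omega) (by omega)
      rw [sum_Ico_eq_of_forall_eq_zero hzero le_rfl] at hle
      have htail := sub_le_sum_Ico hl (R + 2)
      rw [hL] at htail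
      omega
  · have hle := add_sum_Ico_le_sum_range (f := fun i => l i - m i) (i := 0) (q := L - r)
      (L := L) (by omega) (by omega)
    rw [sum_Ico_eq_of_forall_eq_zero hzero (by omega)] at hle
    have htail := sub_le_sum_Ico hl (L - r)
    rw [hL] at htail
    have hbig' := hbig (by omega)
    have h1 := hoff 1 (by omega)
    have h01 : m 1 ≤ m 0 := hm.1 (Nat.zero_le 1)
    rcases lt_or_ge (m 1) (m 0) with h | h
    · have := hstuck 0 (Or.inl rfl) h
      omega
    · omega

/-- A corner can be removed from the rows with index at least `q`. -/
theorem exists_corner_bottom {l m : ℕ → ℕ} {r L q : ℕ} (hr : 14 ≤ r)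
    (hl : IsPartition l) (hL : conj l 0 = L) (hsum : ∑ i ∈ Finset.range L, l i = 6 * r - 3)
    (hbig : 2 * r - 1 ≤ ∑ i ∈ Finset.Ico q L, l i)
    (hbig' : r - 2 ≤ ∑ i ∈ Finset.Ico (q + 1) L, l i)
    (hm : IsPartition m) (hml : ∀ i, m i ≤ l i) (hm0 : m 0 ≤ 2 * r + 2)
    (hM : 4 * r - 2 < ∑ i ∈ Finset.range L, m i) :
    ∃ i, q ≤ i ∧ m (i + 1) < m i ∧ l i < m i + (r + 1) := by
  by_contra! hstuck
  have hrest := sum_range_sub_add_sum_range hml L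
  have hmR := fun i => lt_conj_iff hm i 0
  have hRL : conj m 0 ≤ L := by
    by_contra hlt
    have h₁ := (hmR L).mp (not_le.mp hlt)
    have h₂ := (lt_conj_iff hl L 0).not
    have := hml L
    omega
  rcases le_or_gt (conj m 0) 1 with hR | hR
  · have := sum_range_le_of_conj_le_one hm hR L
    omega
  obtain ⟨R, hRe⟩ : ∃ R, conj m 0 = R + 2 := ⟨_, (Nat.sub_add_cancel hR).symm⟩
  rw [hRe] at hmR hRL
  have hzero : ∀ i, R + 2 ≤ i → m i = 0 := fun i hi => by
    have := hmR i
    omega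
  have hlastpos := (hmR (R + 1)).mp (by omega)
  have hend : m (R + 1 + 1) = 0 := hzero _ le_rfl
  by_cases h₁ : q ≤ R + 1
  · by_cases h₀ : q ≤ R
    · have := two_mul_le_sum_of_last_rows (S := fun i => q ≤ i) (R := R) (L := L) hl.1
        hstuck hm.1 (fun i => (hmR i).symm) (by omega) h₁ h₀
      omega
    · obtain rfl : q = R + 1 := by omega
      have hfull := hstuck (R + 1) h₁ (by omega)
      have hle := add_sum_Ico_le_sum_range (f := fun i => l i - m i) (i := R + 1) (q := R + 2)
        (L := L) (by omega) (by omega)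
      rw [sum_Ico_eq_of_forall_eq_zero hzero le_rfl] at hle
      have : ∑ i ∈ Finset.Ico (R + 1 + 1) L, l i = ∑ i ∈ Finset.Ico (R + 2) L, l i := rfl
      omega
  · have hle := sum_Ico_le_sum_range (f := fun i => l i - m i) (q := q) (L := L)
    rw [sum_Ico_eq_of_forall_eq_zero hzero (by omega)] at hle
    omega

/-- The subdiagram `m` of `l` has `4 * r - 2` cells and fits into the square of side `2 * r + 2`,
and the multiset of row lengths of `l / m` fits into the square of side `r + 1` without being
`(r, r - 1)`, `(r, 1 ^ (r - 1))` or the conjugate of one of these. -/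
structure IsAdmissibleSub (r : ℕ) (l m : ℕ → ℕ) : Prop where
  isPartition : IsPartition m
  le : ∀ i, m i ≤ l i
  sum_eq : ∑ i ∈ Finset.range (conj l 0), m i = 4 * r - 2
  first_le : m 0 ≤ 2 * r + 2
  length_le : conj m 0 ≤ 2 * r + 2
  row_le : ∀ i, l i ≤ m i + (r + 1)
  length_sub_le : conj (fun i => l i - m i) 0 ≤ r + 1
  not_exceptional : ¬(conj (fun i => l i - m i) r = 0 ∧
    (conj (fun i => l i - m i) 0 = 2 ∨ conj (fun i => l i - m i) 0 = r ∧
      (conj (fun i => l i - m i) 1 = 1 ∨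
        conj (fun i => l i - m i) 1 = r - 1 ∧ conj (fun i => l i - m i) 2 = 0)))

theorem eq_zero_of_conj_le {l : ℕ → ℕ} (hl : IsPartition l) {i : ℕ}
    (hi : conj l 0 ≤ i) : l i = 0 := by
  have := lt_conj_iff hl i 0
  omega

theorem card_le_conj_sub {l m : ℕ → ℕ} (hl : IsPartition l) {j : ℕ} (s : Finset ℕ)
    (hs : ∀ i ∈ s, j < l i - m i) : s.card ≤ conj (fun i => l i - m i) j := by
  rw [conj_eq_card (N := conj l 0) fun i hi => by rw [eq_zero_of_conj_le hl hi, Nat.zero_sub]]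
  refine Finset.card_le_card fun i hi => ?_
  have h := hs i hi
  simp only [Finset.mem_filter, Finset.mem_range, lt_conj_iff hl i 0]
  omega

theorem conj_sub_zero_le_card {l m : ℕ → ℕ} (hl : IsPartition l) {S : ℕ → Prop}
    [DecidablePred S]     (hoff : ∀ i, ¬S i → m i = l i) :
    conj (fun i => l i - m i) 0 ≤ ((Finset.range (conj l 0)).filter S).card := by
  rw [conj_eq_card (N := conj l 0) fun i hi => by rw [eq_zero_of_conj_le hl hi, Nat.zero_sub]]
  refine Finset.card_le_card fun i hi => ?_
  simp only [Finset.mem_filter] at hi ⊢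
  refine ⟨hi.1, ?_⟩
  by_contra hS
  have := hoff i hS
  omega

/-- An approximation `m₀` from above can be completed to an admissible subdiagram when there are
always enough removable corners. -/
theorem exists_isAdmissibleSub_of_corner {l m₀ : ℕ → ℕ} {S : ℕ → Prop} [DecidablePred S] {r L : ℕ}
    (hr : 14 ≤ r) (hl : IsPartition l) (hL : conj l 0 = L) (hsum : ∑ i ∈ Finset.range L, l i = 6 * r - 3)
    (hcorner : ∀ m : ℕ → ℕ, IsPartition m → (∀ i, m i ≤ l i) → m 0 ≤ 2 * r + 2 →
      (∀ i, ¬S i → m i = l i) → 4 * r - 2 < ∑ i ∈ Finset.range L, m i →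
      ∃ i, S i ∧ m (i + 1) < m i ∧ l i < m i + (r + 1))
    (hS : ((Finset.range L).filter S).card ≤ r + 1)
    (hanti : Antitone m₀) (hle : ∀ i, m₀ i ≤ l i) (hfirst : m₀ 0 ≤ 2 * r + 2)
    (hlength : m₀ (2 * r + 2) = 0) (hrow : ∀ i, l i ≤ m₀ i + (r + 1))
    (hoff : ∀ i, ¬S i → m₀ i = l i)
    (hsmall : ∑ i ∈ Finset.range L, (l i - m₀ i) ≤ 2 * r - 1)
    (hexc : ∀ m : ℕ → ℕ, (∀ i, m i ≤ m₀ i) →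
      conj (fun i => l i - m i) 0 ≤ ((Finset.range L).filter S).card →
      ¬(conj (fun i => l i - m i) r = 0 ∧
        (conj (fun i => l i - m i) 0 = 2 ∨ conj (fun i => l i - m i) 0 = r ∧
          (conj (fun i => l i - m i) 1 = 1 ∨
            conj (fun i => l i - m i) 1 = r - 1 ∧ conj (fun i => l i - m i) 2 = 0)))) :
    ∃ m, IsAdmissibleSub r l m := by
  subst hL
  have hpart : ∀ m : ℕ → ℕ, Antitone m → (∀ i, m i ≤ m₀ i) → IsPartition m := fun m h h' =>
    ⟨h, conj l 0, fun i hi => by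
      have := eq_zero_of_conj_le hl hi
      have := hle i
      have := h' i
      omega⟩
  have hadd := sum_range_sub_add_sum_range hle (conj l 0)
  obtain ⟨m, h₁, h₂, h₃, h₄, h₅⟩ := exists_partition_of_removable_corner (l := l) (S := S)
    (C := r + 1) (M := 4 * r - 2) (L := conj l 0) (m₀ := m₀)
    (fun m h₁ h₂ _ h₄ h₅ => hcorner m (hpart m h₁ h₂) (fun i => (h₂ i).trans (hle i))
      ((h₂ 0).trans hfirst) h₄ h₅)
    hanti hrow hoff
    (fun i hi => Nat.le_zero.mp ((hle i).trans (eq_zero_of_conj_le hl hi).le)) (by omega)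
  have hcol := conj_sub_zero_le_card hl h₄
  refine ⟨m, hpart m h₁ h₂, fun i => (h₂ i).trans (hle i), h₅, (h₂ 0).trans hfirst, ?_, h₃,
    hcol.trans hS, hexc m h₂ hcol⟩
  by_contra hlt
  have := (lt_conj_iff (hpart m h₁ h₂) (2 * r + 2) 0).mp (not_le.mp hlt)
  have := h₂ (2 * r + 2)
  omega

theorem card_filter_first_or_bottom_le (r L : ℕ) :
    ((Finset.range L).filter fun i => i = 0 ∨ L - r ≤ i).card ≤ r + 1 := by
  have hsub : ((Finset.range L).filter fun i => i = 0 ∨ L - r ≤ i) ⊆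
      insert 0 (Finset.Ico (L - r) L) := fun i hi => by
    simp only [Finset.mem_filter, Finset.mem_range, Finset.mem_insert, Finset.mem_Ico] at hi ⊢
    omega
  have h₁ := Finset.card_le_card hsub
  have h₂ := Finset.card_insert_le 0 (Finset.Ico (L - r) L)
  rw [Nat.card_Ico] at h₂
  omega

theorem card_filter_le_range (q L : ℕ) :
    ((Finset.range L).filter fun i => q ≤ i).card ≤ L - q := by
  have hsub : ((Finset.range L).filter fun i => q ≤ i) ⊆ Finset.Ico q L := fun i hi => by
    simp only [Finset.mem_filter, Finset.mem_range, Finset.mem_Ico] at hi ⊢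
    omega
  simpa using Finset.card_le_card hsub

theorem sum_range_le_of_le_indicators {f : ℕ → ℕ} {x y q Q M L : ℕ}
    (h : ∀ i, i < L → f i ≤ (if i = 0 then x else 0) + (if i = 1 then y else 0) +
      (if q ≤ i then 1 else 0) + (if Q ≤ i ∧ i < M then 1 else 0)) :
    ∑ i ∈ Finset.range L, f i ≤ x + y + (L - q) + (M - Q) := by
  refine (Finset.sum_le_sum fun i hi => h i (Finset.mem_range.mp hi)).trans ?_
  simp only [Finset.sum_add_distrib]
  refine add_le_add (add_le_add (add_le_add ?_ ?_) ?_) ?_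
  · rw [Finset.sum_ite_eq']; split_ifs <;> omega
  · rw [Finset.sum_ite_eq']; split_ifs <;> omega
  · rw [Finset.sum_boole]; exact card_filter_le_range q L
  · rw [Finset.sum_boole, ← Nat.card_Ico]
    refine Finset.card_le_card fun i hi => ?_
    simp only [Finset.mem_filter, Finset.mem_Ico] at hi ⊢
    exact hi.2

theorem sub_add_sub_le_sum_Ico {l : ℕ → ℕ} (hl : IsPartition l) (q : ℕ) :
    (conj l 0 - q) + (conj l 1 - q) ≤ ∑ i ∈ Finset.Ico q (conj l 0), l i := by
  have hle : conj l 1 ≤ conj l 0 := by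
    by_contra hlt
    have h₀ := lt_conj_iff hl (conj l 0) 0
    have h₁ := lt_conj_iff hl (conj l 0) 1
    omega
  calc (conj l 0 - q) + (conj l 1 - q)
      = ∑ i ∈ Finset.Ico q (conj l 0), 1 + ∑ i ∈ Finset.Ico q (conj l 1), 1 := by simp
    _ ≤ ∑ i ∈ Finset.Ico q (conj l 0), 1 +
        ∑ i ∈ Finset.Ico q (conj l 0), (if i < conj l 1 then 1 else 0) := by
      refine Nat.add_le_add_left ?_ _
      rw [← Finset.sum_filter]
      refine Finset.sum_le_sum_of_subset fun i hi => ?_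
      simp only [Finset.mem_filter, Finset.mem_Ico] at hi ⊢
      omega
    _ ≤ _ := by
      rw [← Finset.sum_add_distrib]
      refine Finset.sum_le_sum fun i hi => ?_
      have h₀ := lt_conj_iff hl i 0
      have h₁ := lt_conj_iff hl i 1
      have := (Finset.mem_Ico.mp hi).2
      split_ifs <;> omega

theorem succ_mul_le_sum_range {l : ℕ → ℕ} (hl : IsPartition l) (i : ℕ) :
    (i + 1) * l i ≤ ∑ x ∈ Finset.range (conj l 0), l x := by
  by_cases hi : i < conj l 0
  · calc (i + 1) * l i = ∑ x ∈ Finset.range (i + 1), l i := by simp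
      _ ≤ ∑ x ∈ Finset.range (i + 1), l x := Finset.sum_le_sum fun x hx =>
        hl.1 (Nat.lt_succ_iff.mp (Finset.mem_range.mp hx))
      _ ≤ _ := Finset.sum_le_sum_of_subset (Finset.range_mono hi)
  · rw [eq_zero_of_conj_le hl (not_lt.mp hi), Nat.mul_zero]
    exact Nat.zero_le _

theorem antitone_of_first_le_of_succ_le {f : ℕ → ℕ} (h₀ : f 1 ≤ f 0)
    (h : ∀ n, 1 ≤ n → f (n + 1) ≤ f n) : Antitone f := by
  refine antitone_nat_of_succ_le fun n => ?_
  rcases Nat.eq_zero_or_pos n with rfl | hn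
  · exact h₀
  · exact h n hn

/-- Elementary consequences of the size and first-row conditions on `l`. -/
theorem length_and_row_bounds {l : ℕ → ℕ} {r : ℕ} (hr : 14 ≤ r) (hl : IsPartition l)
    (hsum : ∑ i ∈ Finset.range (conj l 0), l i = 6 * r - 3) (h0 : l 0 ≤ 3 * r + 3)
    (hb : conj l 0 - conj l 1 ≤ l 0 - l 1) :
    2 ≤ conj l 0 ∧ 1 ≤ conj l 1 ∧ conj l 1 ≤ conj l 0 ∧ 1 ≤ l 1 ∧ l 1 ≤ l 0 ∧ l 2 < 2 * r ∧
      l 0 + l 1 + ((conj l 0 - 2) + (conj l 1 - 2)) ≤ 6 * r - 3 ∧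
      ∀ i, 2 * r + 2 ≤ i → l i ≤ 2 := by
  have hL : 2 ≤ conj l 0 := by
    by_contra hlt
    have := sum_range_le_of_conj_le_one hl (by omega) (conj l 0)
    omega
  have h1 : 1 ≤ l 1 := (lt_conj_iff hl 1 0).mp (by omega)
  have h10 : l 1 ≤ l 0 := hl.1 (Nat.zero_le 1)
  have htail := sub_add_sub_le_sum_Ico hl 2
  have hsplit : ∑ i ∈ Finset.range (conj l 0), l i =
      l 0 + l 1 + ∑ i ∈ Finset.Ico 2 (conj l 0), l i := by
    rw [Finset.range_eq_Ico, Finset.sum_eq_sum_Ico_succ_bot (by omega),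
      Finset.sum_eq_sum_Ico_succ_bot (by omega), ← add_assoc]
  have hsq := succ_mul_le_sum_range hl (2 * r + 2)
  have h2 := succ_mul_le_sum_range hl 2
  have hQ : l (2 * r + 2) ≤ 2 := by
    by_contra hlt
    have := Nat.mul_le_mul_left (2 * r + 2 + 1) (not_le.mp hlt)
    omega
  have hL2 : 1 ≤ conj l 1 := by
    have := lt_conj_iff hl 0 1
    omega
  refine ⟨hL, hL2, ?_, h1, h10, by omega, by omega, fun i hi => (hl.1 hi).trans hQ⟩
  by_contra hlt
  have h₀ := lt_conj_iff hl (conj l 0) 0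
  have h₁ := lt_conj_iff hl (conj l 0) 1
  omega

theorem exists_isAdmissibleSub_of_first_or_bottom {l m₀ : ℕ → ℕ} {r : ℕ} (hr : 14 ≤ r)
    (hl : IsPartition l) (hsum : ∑ i ∈ Finset.range (conj l 0), l i = 6 * r - 3)
    (hbig : 2 ≤ conj l 0 - r →
      2 * r - 1 ≤ l 0 - l 1 + ∑ i ∈ Finset.Ico (conj l 0 - r) (conj l 0), l i)
    (hanti : Antitone m₀) (hle : ∀ i, m₀ i ≤ l i) (hfirst : m₀ 0 ≤ 2 * r + 2)
    (hlength : m₀ (2 * r + 2) = 0) (hrow : ∀ i, l i ≤ m₀ i + (r + 1))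
    (hoff : ∀ i, ¬(i = 0 ∨ conj l 0 - r ≤ i) → m₀ i = l i)
    (hsmall : ∑ i ∈ Finset.range (conj l 0), (l i - m₀ i) ≤ 2 * r - 1)
    (hexc : ∀ m : ℕ → ℕ, (∀ i, m i ≤ m₀ i) → conj (fun i => l i - m i) 0 ≤ conj l 0 →
      ¬(conj (fun i => l i - m i) r = 0 ∧
        (conj (fun i => l i - m i) 0 = 2 ∨ conj (fun i => l i - m i) 0 = r ∧
          (conj (fun i => l i - m i) 1 = 1 ∨
            conj (fun i => l i - m i) 1 = r - 1 ∧ conj (fun i => l i - m i) 2 = 0)))) :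
    ∃ m, IsAdmissibleSub r l m :=
  exists_isAdmissibleSub_of_corner hr hl rfl hsum
    (fun _ hm hml hm0 hoff' hM =>
      exists_corner_first_or_bottom hr hl rfl hsum hbig hm hml hm0 hoff' hM)
    (card_filter_first_or_bottom_le r (conj l 0)) hanti hle hfirst hlength hrow hoff hsmall
    fun m h h' => hexc m h (h'.trans ((Finset.card_filter_le _ _).trans_eq (Finset.card_range _)))

theorem exists_isAdmissibleSub_of_long_first_row {l : ℕ → ℕ} {r : ℕ} (hr : 14 ≤ r)
    (hl : IsPartition l) (hsum : ∑ i ∈ Finset.range (conj l 0), l i = 6 * r - 3)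
    (h0 : l 0 ≤ 3 * r + 3) (hb : conj l 0 - conj l 1 ≤ l 0 - l 1) (ha : l 1 + (r + 1) ≤ l 0) :
    ∃ m, IsAdmissibleSub r l m := by
  obtain ⟨hL, hL2, hL21, h1, h10, h2, hs, hQ⟩ := length_and_row_bounds hr hl hsum h0 hb
  refine exists_isAdmissibleSub_of_first_or_bottom (m₀ := fun i =>
    if 2 * r + 2 ≤ i then 0 else if i = 0 then l 0 - (r + 1) else l i) hr hl hsum ?_
    (antitone_of_first_le_of_succ_le ?_ fun n hn => ?_) (fun i => ?_) ?_ ?_ (fun i => ?_)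
    (fun i hi => ?_) ((sum_range_le_of_le_indicators (x := r + 1) (y := 0) (q := 2 * r + 2)
      (Q := 2 * r + 2) (M := conj l 1) fun i hi => ?_).trans ?_) fun m hm hcol => ?_
  · have := sub_le_sum_Ico hl (conj l 0 - r)
    omega
  · split_ifs <;> omega
  · have : l (n + 1) ≤ l n := hl.1 (Nat.le_succ n)
    have hne : n + 1 ≠ 0 := n.succ_ne_zero
    simp only [hne, if_false]
    split_ifs <;> omega
  · rcases Nat.eq_zero_or_pos i with rfl | hi <;> split_ifs <;> omega
  · split_ifs <;> omega
  · split_ifs <;> omega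
  · have := hQ i
    rcases Nat.eq_zero_or_pos i with rfl | hi <;> split_ifs <;> omega
  · have := hQ i
    have := eq_zero_of_conj_le hl (i := i)
    split_ifs <;> omega
  · have := hQ i
    have := lt_conj_iff hl i 1
    rcases Nat.eq_zero_or_pos i with rfl | hi <;> split_ifs <;> omega
  · omega
  · have := card_le_conj_sub (m := m) (j := r) hl {0} fun i hi => by
      obtain rfl := Finset.mem_singleton.mp hi
      have := hm 0
      split_ifs at this <;> omega
    rw [Finset.card_singleton] at this
    omega

theorem exists_isAdmissibleSub_of_long_first_column {l : ℕ → ℕ} {r : ℕ} (hr : 14 ≤ r)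
    (hl : IsPartition l) (hsum : ∑ i ∈ Finset.range (conj l 0), l i = 6 * r - 3)
    (h0 : l 0 ≤ 3 * r + 3) (hb : conj l 0 - conj l 1 ≤ l 0 - l 1) (ha : l 1 + 1 ≤ l 0)
    (ha' : l 0 ≤ l 1 + r) (hlen : r + 1 ≤ conj l 0) :
    ∃ m, IsAdmissibleSub r l m := by
  obtain ⟨hL, hL2, hL21, h1, h10, h2, hs, hQ⟩ := length_and_row_bounds hr hl hsum h0 hb
  refine exists_isAdmissibleSub_of_first_or_bottom (m₀ := fun i =>
    if 2 * r + 2 ≤ i then 0 else if i = 0 then min (2 * r + 2) (l 0 - 1) else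
      if conj l 0 - r ≤ i then l i - 1 else l i) hr hl hsum ?_
    (antitone_of_first_le_of_succ_le ?_ fun n hn => ?_) (fun i => ?_) ?_ ?_ (fun i => ?_)
    (fun i hi => ?_) ((sum_range_le_of_le_indicators (x := max 1 (l 0 - (2 * r + 2))) (y := 0)
      (q := conj l 0 - r) (Q := 2 * r + 2) (M := conj l 1) fun i hi => ?_).trans ?_)
    fun m hm hcol => ?_
  · have := sub_add_sub_le_sum_Ico hl (conj l 0 - r)
    omega
  · split_ifs <;> omega
  · have : l (n + 1) ≤ l n := hl.1 (Nat.le_succ n)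
    have hne : n + 1 ≠ 0 := n.succ_ne_zero
    simp only [hne, if_false]
    split_ifs <;> omega
  · rcases Nat.eq_zero_or_pos i with rfl | hi <;> split_ifs <;> omega
  · split_ifs <;> omega
  · split_ifs <;> omega
  · have := hQ i
    rcases Nat.eq_zero_or_pos i with rfl | hi <;> split_ifs <;> omega
  · split_ifs <;> omega
  · have := hQ i
    have := lt_conj_iff hl i 1
    rcases Nat.eq_zero_or_pos i with rfl | hi <;> split_ifs <;> omega
  · omega
  · have := card_le_conj_sub (m := m) (j := 0) hl (insert 0 (Finset.Ico (conj l 0 - r) (conj l 0)))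
      fun i hi => by
        simp only [Finset.mem_insert, Finset.mem_Ico] at hi
        have hpos := lt_conj_iff hl i 0
        have := hm i
        rcases Nat.eq_zero_or_pos i with rfl | hi <;> split_ifs at this <;> omega
    rw [Finset.card_insert_of_notMem (by simp only [Finset.mem_Ico]; omega), Nat.card_Ico] at this
    omega

theorem exists_isAdmissibleSub_of_equal_first_rows {l : ℕ → ℕ} {r : ℕ} (hr : 14 ≤ r)
    (hl : IsPartition l) (hsum : ∑ i ∈ Finset.range (conj l 0), l i = 6 * r - 3)
    (h0 : l 0 ≤ 3 * r + 3) (hb : conj l 0 - conj l 1 ≤ l 0 - l 1) (ha : l 0 = l 1)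
    (hlen : r + 1 ≤ conj l 0) : ∃ m, IsAdmissibleSub r l m := by
  obtain ⟨hL, hL2, hL21, h1, h10, h2, hs, hQ⟩ := length_and_row_bounds hr hl hsum h0 hb
  have htail := sub_add_sub_le_sum_Ico hl (conj l 0 - (r + 1))
  have htail' := sub_add_sub_le_sum_Ico hl (conj l 0 - (r + 1) + 1)
  have hcard := card_filter_le_range (conj l 0 - (r + 1)) (conj l 0)
  refine exists_isAdmissibleSub_of_corner (S := fun i => conj l 0 - (r + 1) ≤ i) (m₀ := fun i =>
    if 2 * r + 2 ≤ i then 0 else if conj l 0 - (r + 1) ≤ i then l i - 1 else l i) hr hl rfl hsum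
    (fun _ hm hml hm0 _ hM => exists_corner_bottom hr hl rfl hsum (by omega) (by omega)
      hm hml hm0 hM) (by omega) (antitone_nat_of_succ_le fun n => ?_) (fun i => ?_) ?_ ?_
    (fun i => ?_) (fun i hi => ?_) ((sum_range_le_of_le_indicators (x := 0) (y := 0)
      (q := conj l 0 - (r + 1)) (Q := 2 * r + 2) (M := conj l 1) fun i hi => ?_).trans ?_)
    fun m hm hcol => ?_
  · have : l (n + 1) ≤ l n := hl.1 (Nat.le_succ n)
    split_ifs <;> omega
  · split_ifs <;> omega
  · split_ifs <;> omega
  · split_ifs <;> omega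
  · have := hQ i
    split_ifs <;> omega
  · split_ifs <;> omega
  · have := hQ i
    have := lt_conj_iff hl i 1
    split_ifs <;> omega
  · omega
  · have := card_le_conj_sub (m := m) (j := 0) hl (Finset.Ico (conj l 0 - (r + 1)) (conj l 0))
      fun i hi => by
        simp only [Finset.mem_Ico] at hi
        have hpos := lt_conj_iff hl i 0
        have := hm i
        split_ifs at this <;> omega
    rw [Nat.card_Ico] at this
    omega

theorem exists_isAdmissibleSub_of_length_eq {l : ℕ → ℕ} {r : ℕ} (hr : 14 ≤ r)
    (hl : IsPartition l) (hsum : ∑ i ∈ Finset.range (conj l 0), l i = 6 * r - 3)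
    (h0 : l 0 ≤ 3 * r + 3) (hb : conj l 0 - conj l 1 ≤ l 0 - l 1) (ha : l 1 + 2 ≤ l 0)
    (ha' : l 0 ≤ l 1 + r) (hlen : conj l 0 = r) :
    ∃ m, IsAdmissibleSub r l m := by
  obtain ⟨hL, hL2, hL21, h1, h10, h2, hs, hQ⟩ := length_and_row_bounds hr hl hsum h0 hb
  have hL22 : 2 ≤ conj l 1 := by
    by_contra hlt
    have hone := fun i => lt_conj_iff hl i 1
    have h₁ := hone 1
    have hle : ∑ i ∈ Finset.range (conj l 0), l i ≤ l 0 + 0 + (conj l 0 - 0) + (0 - 0) :=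
      sum_range_le_of_le_indicators fun i hi => by
        have := hone i
        rcases Nat.eq_zero_or_pos i with rfl | hi <;> split_ifs <;> omega
    omega
  refine exists_isAdmissibleSub_of_first_or_bottom (m₀ := fun i =>
    if i = 0 then min (2 * r + 2) (l 0 - 3) else
      if i + 1 = conj l 1 then l i - 2 else l i - 1) hr hl hsum (by omega)
    (antitone_of_first_le_of_succ_le ?_ fun n hn => ?_) (fun i => ?_) ?_ ?_ (fun i => ?_)
    (fun i hi => ?_) ((sum_range_le_of_le_indicators (x := max 2 (l 0 - (2 * r + 2) - 1)) (y := 0)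
      (q := 0) (Q := conj l 1 - 1) (M := conj l 1) fun i hi => ?_).trans ?_)
    fun m hm hcol => ?_
  · simp only [one_ne_zero, if_false, if_true]
    split_ifs <;> omega
  · have : l (n + 1) ≤ l n := hl.1 (Nat.le_succ n)
    have hne : n + 1 ≠ 0 := n.succ_ne_zero
    have := lt_conj_iff hl n 1
    have := lt_conj_iff hl (n + 1) 1
    simp only [hne, if_false]
    split_ifs <;> omega
  · rcases Nat.eq_zero_or_pos i with rfl | hi <;> split_ifs <;> omega
  · rw [if_pos rfl]; omega
  · have := eq_zero_of_conj_le hl (i := 2 * r + 2)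
    rw [if_neg (by omega)]
    split_ifs <;> omega
  · rcases Nat.eq_zero_or_pos i with rfl | hi <;> split_ifs <;> omega
  · omega
  · rcases Nat.eq_zero_or_pos i with rfl | hi <;> split_ifs <;> omega
  · omega
  · have hc₀ := card_le_conj_sub (m := m) (j := 0) hl (Finset.range (conj l 0)) fun i hi => by
      have hpos := lt_conj_iff hl i 0
      rw [Finset.mem_range] at hi
      have := hm i
      rcases Nat.eq_zero_or_pos i with rfl | hi <;> split_ifs at this <;> omega
    have hc₁ := card_le_conj_sub (m := m) (j := 1) hl {0, conj l 1 - 1} fun i hi => by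
      have hpos := lt_conj_iff hl i 1
      simp only [Finset.mem_insert, Finset.mem_singleton] at hi
      have := hm i
      rcases Nat.eq_zero_or_pos i with rfl | hi <;> split_ifs at this <;> omega
    have hc₂ := card_le_conj_sub (m := m) (j := 2) hl {0} fun i hi => by
      obtain rfl := Finset.mem_singleton.mp hi
      have := hm 0
      split_ifs at this <;> omega
    rw [Finset.card_range] at hc₀
    rw [Finset.card_pair (by omega)] at hc₁
    rw [Finset.card_singleton] at hc₂
    omega

theorem exists_isAdmissibleSub_of_length_eq_of_le {l : ℕ → ℕ} {r : ℕ} (hr : 14 ≤ r)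
    (hl : IsPartition l) (hsum : ∑ i ∈ Finset.range (conj l 0), l i = 6 * r - 3)
    (h0 : l 0 ≤ 3 * r + 3) (hb : conj l 0 - conj l 1 ≤ l 0 - l 1) (ha : l 0 ≤ l 1 + 1)
    (hlen : conj l 0 = r) : ∃ m, IsAdmissibleSub r l m := by
  obtain ⟨hL, hL2, hL21, h1, h10, h2, hs, hQ⟩ := length_and_row_bounds hr hl hsum h0 hb
  have htail := sub_add_sub_le_sum_Ico hl (1 + 1)
  have hsplit : ∑ i ∈ Finset.range (conj l 0), l i = l 0 + ∑ i ∈ Finset.Ico 1 (conj l 0), l i := by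
    rw [Finset.range_eq_Ico, Finset.sum_eq_sum_Ico_succ_bot (by omega)]
  have hcard := card_filter_le_range 1 (conj l 0)
  refine exists_isAdmissibleSub_of_corner (S := fun i => 1 ≤ i) (m₀ := fun i =>
    if conj l 0 - 3 ≤ i then l i - 1 else l i) hr hl rfl hsum
    (fun _ hm hml hm0 _ hM => exists_corner_bottom hr hl rfl hsum (by omega) (by omega)
      hm hml hm0 hM) (by omega) (antitone_nat_of_succ_le fun n => ?_) (fun i => ?_) ?_ ?_
    (fun i => ?_) (fun i hi => ?_) ((sum_range_le_of_le_indicators (x := 0) (y := 0)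
      (q := conj l 0 - 3) (Q := 0) (M := 0) fun i hi => ?_).trans ?_)
    fun m hm hcol => ?_
  · have : l (n + 1) ≤ l n := hl.1 (Nat.le_succ n)
    split_ifs <;> omega
  · split_ifs <;> omega
  · split_ifs <;> omega
  · have := eq_zero_of_conj_le hl (i := 2 * r + 2)
    split_ifs <;> omega
  · split_ifs <;> omega
  · split_ifs <;> omega
  · split_ifs <;> omega
  · omega
  · have := card_le_conj_sub (m := m) (j := 0) hl (Finset.Ico (conj l 0 - 3) (conj l 0))
      fun i hi => by
        simp only [Finset.mem_Ico] at hi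
        have hpos := lt_conj_iff hl i 0
        have := hm i
        split_ifs at this <;> omega
    rw [Nat.card_Ico] at this
    omega

theorem exists_isAdmissibleSub_of_length_lt {l : ℕ → ℕ} {r : ℕ} (hr : 14 ≤ r)
    (hl : IsPartition l) (hsum : ∑ i ∈ Finset.range (conj l 0), l i = 6 * r - 3)
    (h0 : l 0 ≤ 3 * r + 3) (hb : conj l 0 - conj l 1 ≤ l 0 - l 1)
    (hlen : 3 ≤ conj l 0) (hlen' : conj l 0 < r) : ∃ m, IsAdmissibleSub r l m := by
  obtain ⟨hL, hL2, hL21, h1, h10, h2, hs, hQ⟩ := length_and_row_bounds hr hl hsum h0 hb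
  refine exists_isAdmissibleSub_of_first_or_bottom (m₀ := fun i =>
    min (2 * r + 2) (if conj l 0 - 3 ≤ i then l i - 1 else l i)) hr hl hsum (by omega)
    (antitone_nat_of_succ_le fun n => ?_) (fun i => ?_) ?_ ?_ (fun i => ?_)
    (fun i hi => ?_) ((sum_range_le_of_le_indicators (x := l 0 - (2 * r + 2))
      (y := l 1 - (2 * r + 2)) (q := conj l 0 - 3) (Q := 0) (M := 0) fun i hi => ?_).trans ?_)
    fun m hm hcol => ?_
  · have : l (n + 1) ≤ l n := hl.1 (Nat.le_succ n)
    split_ifs <;> omega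
  · split_ifs <;> omega
  · split_ifs <;> omega
  · have := eq_zero_of_conj_le hl (i := 2 * r + 2)
    split_ifs <;> omega
  · have : l i ≤ l 0 := hl.1 (Nat.zero_le i)
    split_ifs <;> omega
  · omega
  · rcases i with _ | _ | i
    · split_ifs <;> omega
    · simp only [zero_add]
      split_ifs <;> omega
    · have : l (i + 1 + 1) ≤ l 2 := hl.1 (by omega)
      split_ifs <;> omega
  · omega
  · have := card_le_conj_sub (m := m) (j := 0) hl (Finset.Ico (conj l 0 - 3) (conj l 0))
      fun i hi => by
        simp only [Finset.mem_Ico] at hi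
        have hpos := lt_conj_iff hl i 0
        have := hm i
        split_ifs at this <;> omega
    rw [Nat.card_Ico] at this
    omega

theorem exists_isAdmissibleSub_of_two_rows {l : ℕ → ℕ} {r : ℕ} (hr : 14 ≤ r)
    (hl : IsPartition l) (hsum : ∑ i ∈ Finset.range (conj l 0), l i = 6 * r - 3)
    (h0 : l 0 ≤ 3 * r + 3) (hlen : conj l 0 = 2) : ∃ m, IsAdmissibleSub r l m := by
  have hsum' := hsum
  rw [hlen, Finset.sum_range_succ, Finset.sum_range_one] at hsum'
  have h10 : l 1 ≤ l 0 := hl.1 (Nat.zero_le 1)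
  obtain ⟨x, y, hxy, hx, hx', hy, hyx⟩ : ∃ x y, x + y = 2 * r - 1 ∧
      x ≤ r + 1 ∧ l 0 ≤ x + (2 * r + 2) ∧ y ≤ r + 1 ∧ (r + 1 ≤ x ∨ r + 1 ≤ y) ∧
      x ≤ l 0 ∧ y ≤ l 1 ∧ l 1 - y ≤ l 0 - x := by
    rcases le_or_gt (l 0) (3 * r) with h | h
    · exact ⟨r - 2, r + 1, by omega⟩
    · exact ⟨r + 1, r - 2, by omega⟩
  have hzero := fun i => eq_zero_of_conj_le hl (i := i)
  refine exists_isAdmissibleSub_of_first_or_bottom (m₀ := fun i =>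
    if i = 0 then l 0 - x else if i = 1 then l 1 - y else 0) hr hl hsum (by omega)
    (antitone_of_first_le_of_succ_le ?_ fun n hn => ?_) (fun i => ?_) ?_ ?_ (fun i => ?_)
    (fun i hi => ?_) ((sum_range_le_of_le_indicators (x := x)
      (y := y) (q := 2) (Q := 0) (M := 0) fun i hi => ?_).trans ?_)
    fun m hm hcol => ?_
  · simp only [one_ne_zero, if_false, if_true]
    omega
  · rw [if_neg (by omega), if_neg (by omega)]
    exact Nat.zero_le _
  · split_ifs with h h' <;> (try subst h) <;> (try subst h') <;> omega
  · rw [if_pos rfl]; omega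
  · rw [if_neg (by omega), if_neg (by omega)]
  · have := hzero i
    split_ifs with h h' <;> (try subst h) <;> (try subst h') <;> omega
  · omega
  · rw [hlen] at hi
    interval_cases i
    · simp only [if_true]; split_ifs <;> omega
    · simp only [one_ne_zero, if_true, if_false]; split_ifs <;> omega
  · omega
  · rcases hyx.1 with h | h
    · have := card_le_conj_sub (m := m) (j := r) hl {0} fun i hi => by
        obtain rfl := Finset.mem_singleton.mp hi
        have := hm 0
        rw [if_pos rfl] at this
        omega
      rw [Finset.card_singleton] at this
      omega
    · have := card_le_conj_sub (m := m) (j := r) hl {1} fun i hi => by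
        obtain rfl := Finset.mem_singleton.mp hi
        have := hm 1
        rw [if_neg one_ne_zero, if_pos rfl] at this
        omega
      rw [Finset.card_singleton] at this
      omega

/-- A partition whose first row exceeds the second by at least as much as its first column exceeds
the second column has an admissible subdiagram. -/
theorem exists_isAdmissibleSub {l : ℕ → ℕ} {r : ℕ} (hr : 14 ≤ r)
    (hl : IsPartition l) (hsum : ∑ i ∈ Finset.range (conj l 0), l i = 6 * r - 3)
    (h0 : l 0 ≤ 3 * r + 3) (hb : conj l 0 - conj l 1 ≤ l 0 - l 1) :
    ∃ m, IsAdmissibleSub r l m := by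
  obtain ⟨hL, -, -, -, h10, -⟩ := length_and_row_bounds hr hl hsum h0 hb
  rcases lt_or_ge (l 1 + r) (l 0) with ha | ha
  · exact exists_isAdmissibleSub_of_long_first_row hr hl hsum h0 hb (by omega)
  rcases lt_or_ge r (conj l 0) with hlen | hlen
  · rcases h10.lt_or_eq with h | h
    · exact exists_isAdmissibleSub_of_long_first_column hr hl hsum h0 hb h ha hlen
    · exact exists_isAdmissibleSub_of_equal_first_rows hr hl hsum h0 hb h.symm hlen
  rcases hlen.lt_or_eq with hlen | hlen
  · rcases hL.lt_or_eq with h | h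
    · exact exists_isAdmissibleSub_of_length_lt hr hl hsum h0 hb h hlen
    · exact exists_isAdmissibleSub_of_two_rows hr hl hsum h0 h.symm
  · rcases lt_or_ge (l 1 + 1) (l 0) with h | h
    · exact exists_isAdmissibleSub_of_length_eq hr hl hsum h0 hb h ha hlen
    · exact exists_isAdmissibleSub_of_length_eq_of_le hr hl hsum h0 hb h hlen

theorem ofList_pair_apply (a b i : ℕ) :
    ofList [a, b] i = if i = 0 then a else if i = 1 then b else 0 := by
  rcases i with _ | _ | i <;> simp [ofList]

theorem hookP_apply (a b i : ℕ) :
    hookP a b i = if i = 0 then a else if i ≤ b then 1 else 0 := by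
  rcases i with _ | i
  · simp [hookP, ofList]
  · rw [if_neg i.succ_ne_zero]
    simp only [hookP, ofList, List.getD_eq_getElem?_getD, List.getElem?_cons_succ,
      List.getElem?_replicate, Nat.succ_le_iff]
    split_ifs <;> rfl

theorem isPartition_ofList_pair {a b : ℕ} (h : b ≤ a) : IsPartition (ofList [a, b]) := by
  refine ⟨antitone_of_first_le_of_succ_le ?_ fun n hn => ?_, 2, fun i hi => ?_⟩
  · simpa [ofList_pair_apply] using h
  · rw [ofList_pair_apply, if_neg (by omega), if_neg (by omega)]
    exact Nat.zero_le _
  · rw [ofList_pair_apply, if_neg (by omega), if_neg (by omega)]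

theorem isPartition_hookP {a b : ℕ} (h : 1 ≤ a) : IsPartition (hookP a b) := by
  refine ⟨antitone_of_first_le_of_succ_le ?_ fun n hn => ?_, b + 1, fun i hi => ?_⟩
  · simp only [hookP_apply, one_ne_zero, if_false, if_true]
    split_ifs <;> omega
  · have hne : n ≠ 0 := by omega
    simp only [hookP_apply, hne, n.succ_ne_zero, if_false]
    split_ifs <;> omega
  · rw [hookP_apply, if_neg (by omega), if_neg (by omega)]

/-- The values at `0`, `1`, `2` and `r` of the partitions `(r, r - 1)` and `(r, 1 ^ (r - 1))` and of
their conjugates. -/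
theorem values_of_mem_conjClosure {p : ℕ → ℕ} {r : ℕ} (hr : 3 ≤ r)
    (hp : p ∈ conjClosure {ofList [r, r - 1], hookP r (r - 1)}) :
    p r = 0 ∧ (p 0 = 2 ∨ p 0 = r ∧ (p 1 = 1 ∨ p 1 = r - 1 ∧ p 2 = 0)) := by
  rcases hp with (rfl | rfl) | ⟨q, rfl | rfl, rfl⟩
  · refine ⟨?_, Or.inr ⟨rfl, Or.inr ⟨rfl, rfl⟩⟩⟩
    rw [ofList_pair_apply, if_neg (by omega), if_neg (by omega)]
  · refine ⟨?_, Or.inr ⟨rfl, Or.inl ?_⟩⟩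
    · rw [hookP_apply, if_neg (by omega), if_neg (by omega)]
    · rw [hookP_apply, if_neg one_ne_zero, if_pos (by omega)]
  · have hq := isPartition_ofList_pair (Nat.sub_le r 1)
    have h : ∀ i j, i < conj (ofList [r, r - 1]) j ↔
        j < if i = 0 then r else if i = 1 then r - 1 else 0 := fun i j => by
      rw [lt_conj_iff hq, ofList_pair_apply]
    have h₁ := h 0 r
    have h₂ := h 1 0
    have h₃ := h 2 0
    simp only [if_true, one_ne_zero, OfNat.ofNat_ne_zero, OfNat.ofNat_ne_one, if_false]
      at h₁ h₂ h₃
    omega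
  · have hq := isPartition_hookP (b := r - 1) (by omega : 1 ≤ r)
    have h : ∀ i j, i < conj (hookP r (r - 1)) j ↔
        j < if i = 0 then r else if i ≤ r - 1 then 1 else 0 := fun i j => by
      rw [lt_conj_iff hq, hookP_apply]
    have h₁ := h 0 r
    have h₂ := h (r - 1) 0
    have h₃ := h r 0
    have h₄ := h 0 1
    have h₅ := h 1 1
    rw [if_neg (by omega), if_pos le_rfl] at h₂
    rw [if_neg (by omega), if_neg (by omega)] at h₃
    rw [if_neg one_ne_zero, if_pos (by omega)] at h₅
    rw [if_pos rfl] at h₁ h₄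
    omega

theorem mem_conjClosure_of_conj_mem {p : ℕ → ℕ} {A : Set (ℕ → ℕ)} (hp : IsPartition p)
    (hA : ∀ q ∈ A, IsPartition q) (h : conj p ∈ conjClosure A) : p ∈ conjClosure A := by
  rcases h with h | ⟨q, hq, hqp⟩
  · exact Or.inr ⟨conj p, h, conj_conj hp⟩
  · left
    rw [← conj_conj hp, ← hqp, conj_conj (hA q hq)]
    exact hq

theorem IsAdmissibleSub.sum_sub_eq {l m : ℕ → ℕ} {r : ℕ} (h : IsAdmissibleSub r l m) (hr : 1 ≤ r)
    (hsum : ∑ i ∈ Finset.range (conj l 0), l i = 6 * r - 3) :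
    ∑ i ∈ Finset.range (conj l 0), (l i - m i) = 2 * r - 1 := by
  have h₁ := sum_range_sub_add_sum_range h.le (conj l 0)
  have h₂ := h.sum_eq
  omega

theorem IsAdmissibleSub.psize_eq {l m : ℕ → ℕ} {r : ℕ} (h : IsAdmissibleSub r l m)
    (hl : IsPartition l) : psize m = 4 * r - 2 := by
  rw [← h.sum_eq]
  exact psize_eq_sum fun i hi =>
    Nat.le_zero.mp ((h.le i).trans (eq_zero_of_conj_le hl hi).le)

/-- The column lengths of the row-sorted skew shape `l / m` form a partition in the ball. -/
theorem IsAdmissibleSub.conj_sub_mem {l m : ℕ → ℕ} {r : ℕ} (h : IsAdmissibleSub r l m)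
    (hr : 3 ≤ r) (hl : IsPartition l)
    (hsum : ∑ i ∈ Finset.range (conj l 0), l i = 6 * r - 3) :
    (conj fun i => l i - m i) ∈
      Bset (2 * r - 1) (r + 1) \ conjClosure {ofList [r, r - 1], hookP r (r - 1)} := by
  have hz : ∀ i, conj l 0 ≤ i → l i - m i = 0 := fun i hi => by
    rw [eq_zero_of_conj_le hl hi, Nat.zero_sub]
  refine ⟨⟨⟨isPartition_conj hz, ?_⟩, h.length_sub_le, conj_conj_zero_le fun i => ?_⟩,
    fun hmem => h.not_exceptional (values_of_mem_conjClosure hr hmem)⟩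
  · rw [psize_conj hz, h.sum_sub_eq (by omega) hsum]
  · have := h.row_le i
    omega

theorem conj_mem_ball_diff {p : ℕ → ℕ} {r : ℕ} (hr : 3 ≤ r)
    (hp : p ∈ Bset (2 * r - 1) (r + 1) \ conjClosure {ofList [r, r - 1], hookP r (r - 1)}) :
    conj p ∈ Bset (2 * r - 1) (r + 1) \ conjClosure {ofList [r, r - 1], hookP r (r - 1)} := by
  obtain ⟨⟨⟨hpart, hsize⟩, hfirst, hlength⟩, hnot⟩ := hp
  refine ⟨⟨⟨hpart.conj, hpart.psize_conj.trans hsize⟩, hlength, ?_⟩, fun hmem => hnot ?_⟩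
  · rwa [conj_conj hpart]
  · refine mem_conjClosure_of_conj_mem hpart ?_ hmem
    rintro q (rfl | rfl)
    · exact isPartition_ofList_pair (Nat.sub_le r 1)
    · exact isPartition_hookP (by omega)

theorem IsPartition.sum_eq_psize {l : ℕ → ℕ} (hl : IsPartition l) :
    ∑ i ∈ Finset.range (SylowBranching.conj l 0), l i = psize l :=
  (psize_eq_sum fun _ hi => eq_zero_of_conj_le hl hi).symm

theorem mem_starOp_of_mem_ball {l : ℕ → ℕ} {r : ℕ} (hr : 14 ≤ r)
    (h : l ∈ Bset (6 * r - 3) (3 * r + 3)) :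
    l ∈ starOp (Bset (4 * r - 2) (2 * r + 2))
      (Bset (2 * r - 1) (r + 1) \ conjClosure {ofList [r, r - 1], hookP r (r - 1)}) := by
  obtain ⟨⟨hl, hsize⟩, hfirst, hlength⟩ := h
  refine ⟨hl, ?_⟩
  rcases le_total (conj l 0 - conj l 1) (l 0 - l 1) with hb | hb
  · have hsum := hl.sum_eq_psize.trans hsize
    obtain ⟨m, hm⟩ := exists_isAdmissibleSub hr hl hsum hfirst hb
    exact ⟨m, ⟨⟨hm.isPartition, hm.psize_eq hl⟩, hm.first_le, hm.length_le⟩, _,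
      conj_mem_ball_diff (by omega) (hm.conj_sub_mem (by omega) hl hsum),
      LRcoeff_row_lengths_pos hl hm.le⟩
  · have hsum := hl.conj.sum_eq_psize.trans (hl.psize_conj.trans hsize)
    obtain ⟨m, hm⟩ := exists_isAdmissibleSub hr hl.conj hsum hlength (by rwa [conj_conj hl])
    have hmm := conj_conj hm.isPartition
    refine ⟨conj m, ⟨⟨hm.isPartition.conj, hm.isPartition.psize_conj.trans (hm.psize_eq hl.conj)⟩,
      hm.length_le, by rw [hmm]; exact hm.first_le⟩, _,
      hm.conj_sub_mem (by omega) hl.conj hsum, ?_⟩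
    have hle : ∀ i, conj m i ≤ l i := fun i => by
      by_contra hlt
      have h₁ := (lt_conj_iff hm.isPartition (l i) i).mp (not_le.mp hlt)
      have h₂ := (lt_conj_iff hl i (l i)).mp (h₁.trans_le (hm.le (l i)))
      exact h₂.false
    have := LRcoeff_col_lengths_pos hl hm.isPartition.conj hle
    rwa [hmm] at this

theorem mem_ball_of_mem_starOp {l : ℕ → ℕ} {n n' t t' : ℕ} {B : Set (ℕ → ℕ)}
    (hB : B ⊆ Bset n' t') (h : l ∈ starOp (Bset n t) B) : l ∈ Bset (n + n') (t + t') := by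
  obtain ⟨hl, m, ⟨⟨hm, hmn⟩, hm0, hm1⟩, ν, hν, hpos⟩ := h
  obtain ⟨⟨hν', hνn⟩, hν0, hν1⟩ := hB hν
  obtain ⟨hml, T, hT⟩ := exists_isLRFilling_of_LRcoeff_pos hpos
  have h₁ := psize_eq_add_ncard_skewCells hl hml
  have h₂ := IsLRFilling.ncard_eq_psize (finite_skewCells hl) hν' hT
  have h₃ := first_part_le_of_isLRFilling hl hT
  have h₄ := length_le_of_isLRFilling hl hm hν' hT
  exact ⟨⟨hl, by omega⟩, by omega, by omega⟩

/-- for `k ≥ 3` and `r = (3^k + 1)/2`, with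
`B = B_{3^k}(r+1) ∖ {(r, r−1), (r, 1^{r−1})}°`, one has
`B_{2·3^k}(2r+2) ⋆ B = B_{3^{k+1}}(3r+3)`. -/
theorem star_ball_ball (k r : ℕ) (hk : 3 ≤ k) (hr : 2 * r = 3 ^ k + 1) :
    starOp (Bset (2 * 3 ^ k) (2 * r + 2))
        (Bset (3 ^ k) (r + 1) \ conjClosure {ofList [r, r - 1], hookP r (r - 1)}) =
      Bset (3 ^ (k + 1)) (3 * r + 3) := by
  have h27 : 3 ^ 3 ≤ 3 ^ k := Nat.pow_le_pow_right (by omega) hk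
  have hn : 3 ^ k = 2 * r - 1 := by omega
  have hn₂ : 2 * 3 ^ k = 4 * r - 2 := by omega
  have hn₃ : 3 ^ (k + 1) = 6 * r - 3 := by rw [pow_succ]; omega
  rw [hn₃, hn₂, hn]
  refine Set.Subset.antisymm (fun l hl => ?_) fun l hl => mem_starOp_of_mem_ball (by omega) hl
  have h := mem_ball_of_mem_starOp Set.sdiff_subset hl
  rwa [show 4 * r - 2 + (2 * r - 1) = 6 * r - 3 by omega,
    show 2 * r + 2 + (r + 1) = 3 * r + 3 by omega] at h

end SylowBranching
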